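/- arXiv:2602.07473 — 3 statements merged into one kernel-verified Lean document; each statement's English description precedes it below -/
import Mathlib

section
/- Let P be a posterior-deterministic POMDP, f a non-distinguishing SEC of P, b a belief with supp(b) ∈ dom f, and h an observable history inside f from b. Then δ*(b,h) = Σ_{q ∈ supp(b)} b(q) · δ_{δ*(q,h)}, i.e., the updated belief puts probability b(q) on the state δ*(q,h) for each q ∈ supp(b) (where δ* is injective on supp(b)). -/
open scoped ENNReal BigOperators Classical
open Filter Topology

/-- A partially observable Markov decision process with finite state space `Q`,
finite action space `A` and finite observation space `O`.  `tr q a o q'` is the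
probability `T(o, q' | q, a)` of receiving observation `o` and moving to state `q'`
when taking action `a` in state `q`. -/
structure POMDP (Q A O : Type) [Fintype Q] [Fintype A] [Fintype O] where
  tr : Q → A → O → Q → ℝ≥0∞
  tr_sum_one : ∀ q a, (∑ o : O, ∑ q' : Q, tr q a o q') = 1

/-- An (observation-based) strategy: to each observable history it assigns a
probability distribution on actions. -/
structure Strategy (A O : Type) [Fintype A] where
  act : List (A × O) → A → ℝ≥0∞
  act_sum_one : ∀ h, (∑ a : A, act h a) = 1

/-- Support of a (sub-)belief. -/
noncomputable def beliefSupp {Q : Type} [Fintype Q] (b : Q → ℝ≥0∞) : Finset Q :=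
  Finset.univ.filter fun q => b q ≠ 0

/-- Dirac belief at a state. -/
noncomputable def dirac {Q : Type} (q : Q) : Q → ℝ≥0∞ := fun q' => if q' = q then 1 else 0

/-- Restriction of a (sub-)belief to a set of states. -/
noncomputable def restrictBel {Q : Type} (b : Q → ℝ≥0∞) (C : Finset Q) : Q → ℝ≥0∞ :=
  fun q => if q ∈ C then b q else 0

/-- The sequence of states visited by a history. -/
def statesOf {Q A O : Type} (q0 : Q) (l : List (A × O × Q)) : List Q :=
  q0 :: l.map fun x => x.2.2

/-- The observable projection of a history. -/
def obsOf {Q A O : Type} (l : List (A × O × Q)) : List (A × O) :=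
  l.map fun x => (x.1, x.2.1)

/-- A history hits the target set `Tset` for the first time at its last state. -/
def FirstHit {Q A O : Type} (Tset : Set Q) (q0 : Q) (l : List (A × O × Q)) : Prop :=
  (∃ q ∈ Tset, (statesOf q0 l).getLast? = some q) ∧
    ∀ q' ∈ (statesOf q0 l).dropLast, q' ∉ Tset

/-- The prefix of length `n` of an observable run. -/
def runPrefix {A O : Type} (ρ : ℕ → A × O) (n : ℕ) : List (A × O) :=
  List.ofFn fun i : Fin n => ρ i

namespace POMDP

variable {Q A O : Type} [Fintype Q] [Fintype A] [Fintype O]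

/-- Marginal probability `T(o | q, a)` of receiving observation `o`. -/
noncomputable def trO (P : POMDP Q A O) (q : Q) (a : A) (o : O) : ℝ≥0∞ := ∑ q' : Q, P.tr q a o q'

/-- A POMDP is posterior-deterministic if for every `(q, a, o)` there is at most one
successor state with positive probability. -/
def PostDet (P : POMDP Q A O) : Prop :=
  ∀ q a o q₁ q₂, P.tr q a o q₁ ≠ 0 → P.tr q a o q₂ ≠ 0 → q₁ = q₂

/-- The set of possible successors of `q` under action `a` and observation `o`
(in a posterior-deterministic POMDP, at most a singleton: `δ(q,a,o)`). -/
noncomputable def succs (P : POMDP Q A O) (q : Q) (a : A) (o : O) : Finset Q :=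
  Finset.univ.filter fun q' => P.tr q a o q' ≠ 0

/-- `δ(S, a, o)` on sets of states. -/
noncomputable def stepSet (P : POMDP Q A O) (S : Finset Q) (a : A) (o : O) : Finset Q :=
  S.biUnion fun q => P.succs q a o

/-- `δ*(S, h)` on sets of states along an observable history. -/
noncomputable def stepSetStar (P : POMDP Q A O) : Finset Q → List (A × O) → Finset Q
  | S, [] => S
  | S, (a, o) :: h => P.stepSetStar (P.stepSet S a o) h

/-- `T(o | b, a)`, the probability of observing `o` from (sub-)belief `b` after action `a`. -/
noncomputable def trOBel (P : POMDP Q A O) (b : Q → ℝ≥0∞) (a : A) (o : O) : ℝ≥0∞ :=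
  ∑ q : Q, b q * P.trO q a o

/-- Belief update `b_{a,o}`. -/
noncomputable def belStep (P : POMDP Q A O) (b : Q → ℝ≥0∞) (a : A) (o : O) : Q → ℝ≥0∞ :=
  fun q => (∑ q' : Q, b q' * P.tr q' a o q) / P.trOBel b a o

/-- Iterated belief update `δ*(b, h)` along an observable history. -/
noncomputable def belStepStar (P : POMDP Q A O) : (Q → ℝ≥0∞) → List (A × O) → Q → ℝ≥0∞
  | b, [] => b
  | b, (a, o) :: h => P.belStepStar (P.belStep b a o) h

/-- Probability of the continuation of a history under a strategy:
`runProbAux σ hist q l` is the probability, starting from state `q` after the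
observable history `hist`, that the next steps are exactly `l`. -/
noncomputable def runProbAux (P : POMDP Q A O) (σ : Strategy A O) :
    List (A × O) → Q → List (A × O × Q) → ℝ≥0∞
  | _, _, [] => 1
  | hist, q, (a, o, q') :: rest =>
      σ.act hist a * P.tr q a o q' * P.runProbAux σ (hist ++ [(a, o)]) q' rest

/-- Probability `P_b^σ(Cyl(q0, l))` of the cylinder of a history. -/
noncomputable def histProb (P : POMDP Q A O) (b : Q → ℝ≥0∞) (σ : Strategy A O)
    (q0 : Q) (l : List (A × O × Q)) : ℝ≥0∞ :=
  b q0 * P.runProbAux σ [] q0 l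

/-- Probability `P_b^σ(Reach(Tset))` of eventually visiting the target set:
the sum of cylinder probabilities over all histories hitting `Tset` for the first
time at their last state. -/
noncomputable def reachProb (P : POMDP Q A O) (Tset : Set Q) (b : Q → ℝ≥0∞)
    (σ : Strategy A O) : ℝ≥0∞ :=
  ∑' p : Q × List (A × O × Q), if FirstHit Tset p.1 p.2 then P.histProb b σ p.1 p.2 else 0

/-- The reachability value `Val(b) = sup_σ P_b^σ(Reach(Tset))`. -/
noncomputable def val (P : POMDP Q A O) (Tset : Set Q) (b : Q → ℝ≥0∞) : ℝ≥0∞ :=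
  ⨆ σ : Strategy A O, P.reachProb Tset b σ

/-- `Val(b, a) = Σ_o T(o | b, a) · Val(b_{a,o})`. -/
noncomputable def valAct (P : POMDP Q A O) (Tset : Set Q) (b : Q → ℝ≥0∞) (a : A) : ℝ≥0∞ :=
  ∑ o : O, P.trOBel b a o * P.val Tset (P.belStep b a o)

/-- A state is absorbing if once reached the system stays there forever. -/
def Absorbing (P : POMDP Q A O) (q : Q) : Prop :=
  ∀ a o q', P.tr q a o q' ≠ 0 → q' = q

/-- A state is observable if there is an observation received exactly when
entering this state. -/
def Observable (P : POMDP Q A O) (q : Q) : Prop :=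
  ∃ o : O, ∀ p a o' q', P.tr p a o' q' ≠ 0 → (q' = q ↔ o' = o)

/-- An observable history is inside a partial function `(dom, act)` from a support
`S`: every action taken is prescribed by `act` at the current support, which stays
in `dom`. -/
def InsideFrom (P : POMDP Q A O) (dom : Set (Finset Q)) (act : Finset Q → Finset A) :
    Finset Q → List (A × O) → Prop
  | _, [] => True
  | S, (a, o) :: h => S ∈ dom ∧ a ∈ act S ∧ InsideFrom P dom act (P.stepSet S a o) h

/-- A support end component (SEC): a partial function from nonempty belief supports
to nonempty sets of actions, closed under prescribed transitions and strongly
connected via prescribed histories. -/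
structure SEC (P : POMDP Q A O) where
  dom : Set (Finset Q)
  act : Finset Q → Finset A
  dom_nonempty : ∀ S ∈ dom, S.Nonempty
  act_nonempty : ∀ S ∈ dom, (act S).Nonempty
  closed : ∀ S ∈ dom, ∀ a ∈ act S, ∀ o : O, (P.stepSet S a o).Nonempty → P.stepSet S a o ∈ dom
  connected : ∀ S ∈ dom, ∀ S' ∈ dom,
      ∃ h : List (A × O), InsideFrom P dom act S h ∧ P.stepSetStar S h = S'

/-- `f` is contained in `f'`. -/
def SEC.Contained {P : POMDP Q A O} (f f' : SEC P) : Prop :=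
  f.dom ⊆ f'.dom ∧ ∀ S ∈ f.dom, f.act S ⊆ f'.act S

/-- A maximal SEC: any SEC containing it coincides with it. -/
def SEC.Maximal {P : POMDP Q A O} (f : SEC P) : Prop :=
  ∀ f' : SEC P, f.Contained f' → f'.dom = f.dom ∧ ∀ S ∈ f.dom, f'.act S = f.act S

/-- `(f, S)`-indistinguishability of two states `q, q' ∈ S`: along every history
inside `f` from `S`, the observation distributions from the (unique) successors of
`q` and `q'` agree for all prescribed actions. -/
def Indist (P : POMDP Q A O) (f : SEC P) (S : Finset Q) (q q' : Q) : Prop :=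
  ∀ h : List (A × O), InsideFrom P f.dom f.act S h →
    ∀ a ∈ f.act (P.stepSetStar S h), ∀ o : O,
      ∀ x ∈ P.stepSetStar {q} h, ∀ y ∈ P.stepSetStar {q'} h,
        P.trO x a o = P.trO y a o

/-- A distinguishing SEC. -/
def SEC.Distinguishing {P : POMDP Q A O} (f : SEC P) : Prop :=
  ∃ S ∈ f.dom, ∃ q ∈ S, ∃ q' ∈ S, ¬ Indist P f S q q'

/-- A non-distinguishing SEC. -/
def SEC.NonDistinguishing {P : POMDP Q A O} (f : SEC P) : Prop :=
  ∀ S ∈ f.dom, ∀ q ∈ S, ∀ q' ∈ S, Indist P f S q q'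

/-- The `(f,S)`-indistinguishability class of `q` inside `S`. -/
noncomputable def classOf (P : POMDP Q A O) (f : SEC P) (S : Finset Q) (q : Q) : Finset Q :=
  S.filter fun q' => Indist P f S q q'

/-- `Reach_f(b)`: the set of beliefs reachable from `b` by histories inside `f`. -/
def reachBel (P : POMDP Q A O) (f : SEC P) (b : Q → ℝ≥0∞) : Set (Q → ℝ≥0∞) :=
  {b' | ∃ h : List (A × O), InsideFrom P f.dom f.act (beliefSupp b) h ∧ P.belStepStar b h = b'}

/-- An observable run stays inside `f` from the support `S0`. -/
def RunInside (P : POMDP Q A O) (f : SEC P) (S0 : Finset Q) (ρ : ℕ → A × O) : Prop :=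
  ∀ n : ℕ, InsideFrom P f.dom f.act S0 (runPrefix ρ n)

/-- The a-posteriori probability `X_q^n(ρ) = δ*(b, ρ|_n)(δ*(q, ρ|_n))` of having
started in `q`, given the first `n` action-observation pairs of `ρ`. -/
noncomputable def Xpost (P : POMDP Q A O) (b : Q → ℝ≥0∞) (q : Q) (ρ : ℕ → A × O)
    (n : ℕ) : ℝ≥0∞ :=
  ∑ x ∈ P.stepSetStar {q} (runPrefix ρ n), P.belStepStar b (runPrefix ρ n) x

/-- A history `h = h' ++ [(a,o)]` distinguishes `q` and `q'`:
`T(o | δ*(q,h'), a) ≠ T(o | δ*(q',h'), a)`. -/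
def HistDistinguishes (P : POMDP Q A O) (q q' : Q) (h : List (A × O)) : Prop :=
  ∃ (h' : List (A × O)) (ao : A × O), h = h' ++ [ao] ∧
    (∑ x ∈ P.stepSetStar {q} h', P.trO x ao.1 ao.2) ≠
      (∑ x ∈ P.stepSetStar {q'} h', P.trO x ao.1 ao.2)

/-- The number of (nonempty) prefixes of `h` distinguishing `q` and `q'`. -/
noncomputable def distCount (P : POMDP Q A O) (q q' : Q) (h : List (A × O)) : ℕ :=
  ((Finset.range (h.length + 1)).filter fun i => P.HistDistinguishes q q' (h.take i)).card

/-- Probability `P_b^σ(Cyl(h))` of the cylinder of an observable history. -/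
noncomputable def obsCylProb (P : POMDP Q A O) (b : Q → ℝ≥0∞) (σ : Strategy A O)
    (h : List (A × O)) : ℝ≥0∞ :=
  ∑' p : Q × List (A × O × Q), if obsOf p.2 = h then P.histProb b σ p.1 p.2 else 0

/-- Probability `P_b^σ(initial state is q ∧ Cyl(h))`. -/
noncomputable def jointProb (P : POMDP Q A O) (b : Q → ℝ≥0∞) (σ : Strategy A O)
    (q : Q) (h : List (A × O)) : ℝ≥0∞ :=
  ∑' l : List (A × O × Q), if obsOf l = h then P.histProb b σ q l else 0

/-- `X_q^n` evaluated on the `F_n`-atom of the observable history `h`: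
the conditional probability of having started in `q` given `Cyl(h)`. -/
noncomputable def condX (P : POMDP Q A O) (b : Q → ℝ≥0∞) (σ : Strategy A O)
    (q : Q) (h : List (A × O)) : ℝ≥0∞ :=
  P.jointProb b σ q h / P.obsCylProb b σ h

/-- Probability `P_b^σ(∃ prefix whose observable history satisfies E)`: the sum of
cylinder probabilities over histories satisfying `E` for the first time. -/
noncomputable def eventProb (P : POMDP Q A O) (b : Q → ℝ≥0∞) (σ : Strategy A O)
    (E : List (A × O) → Prop) : ℝ≥0∞ :=
  ∑' p : Q × List (A × O × Q),
    if E (obsOf p.2) ∧ ∀ l' : List (A × O × Q), l' <+: p.2 → l' ≠ p.2 → ¬ E (obsOf l')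
    then P.histProb b σ p.1 p.2 else 0

/-- The set of actions used by the uniform strategy of an SEC `f` after an
observable history (the prescribed actions if the current support has some,
all actions otherwise). -/
noncomputable def unifSupport (P : POMDP Q A O) (f : SEC P) (S0 : Finset Q)
    (h : List (A × O)) : Finset A :=
  if (f.act (P.stepSetStar S0 h)).Nonempty then f.act (P.stepSetStar S0 h) else Finset.univ

theorem unifSupport_nonempty [Nonempty A] (P : POMDP Q A O) (f : SEC P) (S0 : Finset Q)
    (h : List (A × O)) : (P.unifSupport f S0 h).Nonempty := by
  unfold unifSupport
  split
  · assumption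
  · exact Finset.univ_nonempty

/-- The uniform strategy `unif_f`: it tracks the current belief support and picks a
prescribed action uniformly at random. -/
noncomputable def unifStrat [Nonempty A] (P : POMDP Q A O) (f : SEC P) (S0 : Finset Q) :
    Strategy A O where
  act h a := if a ∈ P.unifSupport f S0 h then ((P.unifSupport f S0 h).card : ℝ≥0∞)⁻¹ else 0
  act_sum_one := by
    intro h
    have hne := P.unifSupport_nonempty f S0 h
    rw [Finset.sum_ite_mem, Finset.univ_inter, Finset.sum_const, nsmul_eq_mul,
      ENNReal.mul_inv_cancel]
    · exact Nat.cast_ne_zero.mpr (Finset.card_ne_zero.mpr hne)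
    · exact ENNReal.natCast_ne_top _

end POMDP
/-- In a non-distinguishing SEC of a posterior-deterministic
POMDP, the belief reached along a history `h` inside `f` puts probability `b(q)`
on the state `δ*(q, h)` for each `q ∈ supp(b)`. -/
theorem stmt10 {Q A O : Type} [Fintype Q] [Fintype A] [Fintype O]
    (P : POMDP Q A O) (hP : P.PostDet)
    (f : POMDP.SEC P) (hnd : f.NonDistinguishing)
    (b : Q → ℝ≥0∞) (hb : (∑ q : Q, b q) = 1) (hS : beliefSupp b ∈ f.dom)
    (h : List (A × O)) (hh : POMDP.InsideFrom P f.dom f.act (beliefSupp b) h) :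
    ∀ q'' : Q, P.belStepStar b h q'' =
      ∑ q ∈ beliefSupp b, (if q'' ∈ P.stepSetStar {q} h then b q else 0) := by
  induction h generalizing b with
  | nil =>
    intro q''
    simp only [POMDP.belStepStar, POMDP.stepSetStar, Finset.mem_singleton]
    rw [Finset.sum_ite_eq]
    by_cases h0 : b q'' = 0 <;> simp [beliefSupp, h0]
  | cons ao h ih =>
    obtain ⟨a, o⟩ := ao
    obtain ⟨-, ha, hh'⟩ := hh
    intro q''
    obtain ⟨q₀, hq₀⟩ := f.dom_nonempty _ hS
    have hsame : ∀ q ∈ beliefSupp b, P.trO q a o = P.trO q₀ a o := by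
      intro q hq
      exact hnd _ hS q hq q₀ hq₀ [] trivial a ha o q (by simp [POMDP.stepSetStar]) q₀
        (by simp [POMDP.stepSetStar])
    have hmem : ∀ q, q ∈ beliefSupp b ↔ b q ≠ 0 := by intro q; simp [beliefSupp]
    set t := P.trO q₀ a o with ht
    have htle : t ≤ 1 := by
      rw [← P.tr_sum_one q₀ a]
      exact Finset.single_le_sum (f := fun o => ∑ q' : Q, P.tr q₀ a o q')
        (fun _ _ => zero_le) (Finset.mem_univ o)
    have httop : t ≠ ⊤ := ne_top_of_le_ne_top ENNReal.one_ne_top htle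
    have hT : P.trOBel b a o = t := by
      have : P.trOBel b a o = ∑ q : Q, b q * t := by
        refine Finset.sum_congr rfl fun q _ => ?_
        by_cases h0 : b q = 0
        · simp [h0]
        · rw [hsame q ((hmem q).2 h0)]
      rw [this, ← Finset.sum_mul, hb, one_mul]
    have hsing : ∀ q, P.stepSet {q} a o = P.succs q a o := by
      intro q; simp [POMDP.stepSet]
    by_cases h0 : t = 0
    · have hz : ∀ q ∈ beliefSupp b, ∀ p, P.tr q a o p = 0 := by
        intro q hq p
        have := hsame q hq
        rw [h0, POMDP.trO, Finset.sum_eq_zero_iff] at this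
        exact this p (Finset.mem_univ p)
      have hse : ∀ q ∈ beliefSupp b, P.succs q a o = ∅ := by
        intro q hq
        simp [POMDP.succs, hz q hq]
      have hemp : P.stepSet (beliefSupp b) a o = ∅ := by
        rw [Finset.eq_empty_iff_forall_notMem]
        intro p hp
        obtain ⟨q, hq, hpq⟩ := Finset.mem_biUnion.1 hp
        rw [hse q hq] at hpq
        simp at hpq
      rw [hemp] at hh'
      cases h with
      | cons x h =>
        obtain ⟨hd, -, -⟩ := hh'
        exact absurd (f.dom_nonempty _ hd) (by simp)
      | nil =>
        simp only [POMDP.belStepStar, POMDP.stepSetStar, hsing]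
        rw [Finset.sum_eq_zero (fun q hq => by simp [hse q hq])]
        have : ∑ q' : Q, b q' * P.tr q' a o q'' = 0 := by
          refine Finset.sum_eq_zero fun q _ => ?_
          by_cases hq : b q = 0
          · simp [hq]
          · simp [hz q ((hmem q).2 hq)]
        simp [POMDP.belStep, this]
    · have hd : ∀ q, ∃ d, q ∈ beliefSupp b →
          (∀ p, P.tr q a o p = if p = d then t else 0) := by
        intro q
        by_cases hq : q ∈ beliefSupp b
        · have h1 := hsame q hq
          have : ∃ d, P.tr q a o d ≠ 0 := by
            by_contra! hc
            apply h0
            rw [← h1, POMDP.trO]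
            simp [hc]
          obtain ⟨d, hd⟩ := this
          have hne : ∀ p, p ≠ d → P.tr q a o p = 0 := by
            intro p hp
            by_contra hc
            exact hp (hP q a o p d hc hd)
          refine ⟨d, fun _ p => ?_⟩
          split_ifs with hp
          · rw [← h1, POMDP.trO, hp, Finset.sum_eq_single d (fun p _ hp => hne p hp) (by simp)]
          · exact hne p hp
        · exact ⟨q, fun h => absurd h hq⟩
      choose d hd using hd
      have hsucc : ∀ q ∈ beliefSupp b, P.succs q a o = {d q} := by
        intro q hq
        ext p
        simp [POMDP.succs, hd q hq, h0]
      have hset : P.stepSet (beliefSupp b) a o = (beliefSupp b).image d := by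
        unfold POMDP.stepSet
        rw [Finset.biUnion_congr rfl hsucc]
        ext p
        simp [eq_comm]
      have hb' : ∀ p, P.belStep b a o p = ∑ q ∈ beliefSupp b, if p = d q then b q else 0 := by
        intro p
        unfold POMDP.belStep
        have : ∑ q' : Q, b q' * P.tr q' a o p = ∑ q ∈ beliefSupp b, b q * P.tr q a o p := by
          symm
          refine Finset.sum_subset (Finset.subset_univ _) fun q _ hq => ?_
          rw [hmem, not_not] at hq
          simp [hq]
        rw [hT, this, div_eq_mul_inv, Finset.sum_mul]
        refine Finset.sum_congr rfl fun q hq => ?_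
        rw [hd q hq]
        split_ifs
        · rw [mul_assoc, ENNReal.mul_inv_cancel h0 httop, mul_one]
        · simp
      have hsupp : beliefSupp (P.belStep b a o) = P.stepSet (beliefSupp b) a o := by
        rw [hset]
        ext p
        have : p ∈ beliefSupp (P.belStep b a o) ↔ P.belStep b a o p ≠ 0 := by
          simp [beliefSupp]
        rw [this, hb', Ne, Finset.sum_eq_zero_iff, Finset.mem_image]
        push Not
        constructor
        · rintro ⟨q, hq, hne⟩
          refine ⟨q, hq, ?_⟩
          by_contra hc
          exact hne (if_neg fun e => hc e.symm)
        · rintro ⟨q, hq, rfl⟩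
          refine ⟨q, hq, ?_⟩
          rw [if_pos rfl]
          exact (hmem q).1 hq
      have hsum : ∑ p, P.belStep b a o p = 1 := by
        simp only [hb']
        rw [Finset.sum_comm]
        simp only [Finset.sum_ite_eq', Finset.mem_univ, if_true]
        rw [← hb]
        refine Finset.sum_subset (Finset.subset_univ _) fun q _ hq => ?_
        rwa [hmem, not_not] at hq
      have hdom : P.stepSet (beliefSupp b) a o ∈ f.dom := by
        refine f.closed _ hS a ha o ?_
        rw [hset]
        exact ⟨d q₀, Finset.mem_image_of_mem d hq₀⟩
      have key := ih (P.belStep b a o) hsum (hsupp ▸ hdom) (hsupp ▸ hh') q''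
      simp only [POMDP.belStepStar, POMDP.stepSetStar]
      rw [key, hsupp, hset]
      have e1 : ∀ p, (if q'' ∈ P.stepSetStar {p} h then P.belStep b a o p else 0) =
          ∑ q ∈ beliefSupp b, if p = d q then
            (if q'' ∈ P.stepSetStar {p} h then b q else 0) else 0 := by
        intro p
        rw [hb']
        split_ifs <;> simp
      simp only [e1]
      rw [Finset.sum_comm]
      refine Finset.sum_congr rfl fun q hq => ?_
      rw [Finset.sum_ite_eq', if_pos (Finset.mem_image_of_mem d hq)]
      have e2 : P.stepSetStar {d q} h = P.stepSetStar (P.stepSet {q} a o) h := by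
        rw [hsing, hsucc q hq]
      exact if_congr (by rw [e2]) rfl rfl
end

section
/- Let P be a posterior-deterministic POMDP, f an SEC of P, and b an initial belief with supp(b) ∈ dom f. For every q, q' ∈ supp(b), every n ∈ ℕ, and every observable run ρ that stays inside f from b, one has X_{q'}^n(ρ) ≠ 0 and X_q^{n+1}(ρ)/X_{q'}^{n+1}(ρ) = (X_q^n(ρ)/X_{q'}^n(ρ)) · T(o | δ*(q, ρ|_n), a) / T(o | δ*(q', ρ|_n), a), where ρ|_n is the prefix of ρ of length n and (a,o) is the (n+1)-st action-observation pair of ρ. -/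
open scoped ENNReal BigOperators Classical
open Filter Topology

namespace POMDP

variable {Q A O : Type} [Fintype Q] [Fintype A] [Fintype O]

theorem mem_succs' (P : POMDP Q A O) (q : Q) (a : A) (o : O) (y : Q) :
    y ∈ P.succs q a o ↔ P.tr q a o y ≠ 0 := by
  simp [succs]

theorem mem_stepSet' (P : POMDP Q A O) (S : Finset Q) (a : A) (o : O) (y : Q) :
    y ∈ P.stepSet S a o ↔ ∃ x ∈ S, P.tr x a o y ≠ 0 := by
  simp [stepSet, mem_succs']

theorem card_stepSet_le (P : POMDP Q A O) (hP : P.PostDet) (S : Finset Q) (a : A) (o : O) :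
    (P.stepSet S a o).card ≤ S.card := by
  have h := Finset.card_biUnion_le_card_mul S (fun q => P.succs q a o) 1 (by
    intro x _
    rw [Finset.card_le_one]
    intro y hy z hz
    exact hP x a o y z ((P.mem_succs' ..).1 hy) ((P.mem_succs' ..).1 hz))
  simpa [stepSet] using h

theorem card_stepSetStar_le (P : POMDP Q A O) (hP : P.PostDet) (h : List (A × O)) :
    ∀ S : Finset Q, (P.stepSetStar S h).card ≤ S.card := by
  induction h with
  | nil => intro S; simp [stepSetStar]
  | cons ao h ih =>
    intro S
    obtain ⟨a, o⟩ := ao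
    exact (ih _).trans (P.card_stepSet_le hP S a o)

theorem SEC.card_eq {P : POMDP Q A O} (hP : P.PostDet) (f : SEC P) {S S' : Finset Q}
    (hS : S ∈ f.dom) (hS' : S' ∈ f.dom) : S.card = S'.card := by
  obtain ⟨h, -, e⟩ := f.connected S hS S' hS'
  obtain ⟨h', -, e'⟩ := f.connected S' hS' S hS
  have h1 := P.card_stepSetStar_le hP h S
  have h2 := P.card_stepSetStar_le hP h' S'
  rw [e] at h1
  rw [e'] at h2
  omega

theorem exists_succ (P : POMDP Q A O) (hP : P.PostDet) (S : Finset Q) (a : A) (o : O)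
    (hc : (P.stepSet S a o).card = S.card) (x : Q) (hx : x ∈ S) :
    ∃ y, P.tr x a o y ≠ 0 ∧ ∀ x' ∈ S, P.tr x' a o y ≠ 0 → x' = x := by
  by_contra! hcon
  have hsub : P.stepSet S a o ⊆ P.stepSet (S.erase x) a o := by
    intro y hy
    rw [mem_stepSet'] at hy ⊢
    obtain ⟨z, hz, hzy⟩ := hy
    by_cases hzx : z = x
    · subst hzx
      obtain ⟨x', hx', h1, h2⟩ := hcon y hzy
      exact ⟨x', Finset.mem_erase.2 ⟨h2, hx'⟩, h1⟩
    · exact ⟨z, Finset.mem_erase.2 ⟨hzx, hz⟩, hzy⟩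
  have h1 := Finset.card_le_card hsub
  have h2 := P.card_stepSet_le hP (S.erase x) a o
  have h3 := Finset.card_erase_lt_of_mem hx
  omega

theorem stepSetStar_snoc (P : POMDP Q A O) (h : List (A × O)) (ao : A × O) :
    ∀ S, P.stepSetStar S (h ++ [ao]) = P.stepSet (P.stepSetStar S h) ao.1 ao.2 := by
  induction h with
  | nil => intro S; rfl
  | cons x h ih => intro S; exact ih _

theorem belStepStar_snoc (P : POMDP Q A O) (h : List (A × O)) (ao : A × O) :
    ∀ b, P.belStepStar b (h ++ [ao]) = P.belStep (P.belStepStar b h) ao.1 ao.2 := by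
  induction h with
  | nil => intro S; rfl
  | cons x h ih => intro S; exact ih _

theorem insideFrom_snoc (P : POMDP Q A O) (dom : Set (Finset Q)) (act : Finset Q → Finset A)
    (h : List (A × O)) (ao : A × O) :
    ∀ S, InsideFrom P dom act S (h ++ [ao]) → P.stepSetStar S h ∈ dom := by
  induction h with
  | nil => intro S hS; exact hS.1
  | cons x h ih => intro S hS; exact ih _ hS.2.2

theorem runPrefix_succ (ρ : ℕ → A × O) (n : ℕ) :
    runPrefix ρ (n + 1) = runPrefix ρ n ++ [ρ n] := by
  simp only [runPrefix, List.ofFn_succ_last]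
  simp

theorem trO_ne_top (P : POMDP Q A O) (q : Q) (a : A) (o : O) : P.trO q a o ≠ ⊤ := by
  have h : P.trO q a o ≤ ∑ o : O, ∑ q' : Q, P.tr q a o q' :=
    Finset.single_le_sum (f := fun o => ∑ q' : Q, P.tr q a o q') (fun _ _ => zero_le)
      (Finset.mem_univ o)
  rw [P.tr_sum_one] at h
  exact ne_top_of_le_ne_top ENNReal.one_ne_top h

theorem trO_eq (P : POMDP Q A O) (hP : P.PostDet) {x y : Q} {a : A} {o : O}
    (h : P.tr x a o y ≠ 0) : P.trO x a o = P.tr x a o y := by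
  unfold trO
  apply Finset.sum_eq_single_of_mem y (Finset.mem_univ y)
  intro z _ hz
  by_contra hc
  exact hz (hP x a o z y hc h)

theorem trOBel_ne_top (P : POMDP Q A O) (b : Q → ℝ≥0∞) (hb : ∀ q, b q ≠ ⊤) (a : A) (o : O) :
    P.trOBel b a o ≠ ⊤ :=
  ENNReal.sum_ne_top.2 fun q _ => ENNReal.mul_ne_top (hb q) (P.trO_ne_top q a o)

theorem beliefSupp_belStep (P : POMDP Q A O) (b : Q → ℝ≥0∞) (hb : ∀ q, b q ≠ ⊤)
    (a : A) (o : O) :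
    beliefSupp (P.belStep b a o) = P.stepSet (beliefSupp b) a o := by
  ext y
  have hZ := P.trOBel_ne_top b hb a o
  rw [mem_stepSet']
  simp [beliefSupp, belStep, ENNReal.div_eq_zero_iff, hZ, Finset.sum_eq_zero_iff]

/-- One-step update at the successor of `x`. -/
theorem belStep_apply (P : POMDP Q A O) (hP : P.PostDet) (b : Q → ℝ≥0∞) {a : A} {o : O}
    {x y : Q} (hxy : P.tr x a o y ≠ 0)
    (hinj : ∀ x' ∈ beliefSupp b, P.tr x' a o y ≠ 0 → x' = x) :
    P.belStep b a o y = b x * P.trO x a o / P.trOBel b a o := by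
  unfold belStep
  rw [P.trO_eq hP hxy]
  congr 1
  apply Finset.sum_eq_single_of_mem x (Finset.mem_univ x)
  intro z _ hz
  by_contra hc
  have hc := mul_ne_zero_iff.1 hc
  exact hz (hinj z (by simp [beliefSupp, hc.1]) hc.2)

theorem stepSet_singleton (P : POMDP Q A O) (hP : P.PostDet) {a : A} {o : O}
    {x y : Q} (hxy : P.tr x a o y ≠ 0) : P.stepSet {x} a o = {y} := by
  ext z
  rw [mem_stepSet']
  simp only [Finset.mem_singleton, exists_eq_left]
  exact ⟨fun h => hP x a o z y h hxy, fun h => h ▸ hxy⟩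

theorem trOBel_ne_zero (P : POMDP Q A O) (b : Q → ℝ≥0∞) {a : A} {o : O} {x y : Q}
    (hx : x ∈ beliefSupp b) (hxy : P.tr x a o y ≠ 0) : P.trOBel b a o ≠ 0 := by
  intro h
  have h1 := (Finset.sum_eq_zero_iff.1 h) x (Finset.mem_univ x)
  rcases mul_eq_zero.1 h1 with h2 | h2
  · simp [beliefSupp, h2] at hx
  · exact hxy (Finset.sum_eq_zero_iff.1 h2 y (Finset.mem_univ y))

theorem run_invariant (P : POMDP Q A O) (hP : P.PostDet) (f : SEC P)
    (b : Q → ℝ≥0∞) (hb : ∀ q, b q ≠ ⊤)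
    (ρ : ℕ → A × O) (hρ : RunInside P f (beliefSupp b) ρ) (q₀ : Q) (hq₀ : q₀ ∈ beliefSupp b)
    (n : ℕ) :
    beliefSupp (P.belStepStar b (runPrefix ρ n)) = P.stepSetStar (beliefSupp b) (runPrefix ρ n) ∧
    (∀ x, P.belStepStar b (runPrefix ρ n) x ≠ ⊤) ∧
    (∀ p ∈ beliefSupp b, ∃ x ∈ P.stepSetStar (beliefSupp b) (runPrefix ρ n),
      P.stepSetStar {p} (runPrefix ρ n) = {x}) ∧
    (∀ x ∈ P.stepSetStar (beliefSupp b) (runPrefix ρ n), ∃ y, P.tr x (ρ n).1 (ρ n).2 y ≠ 0 ∧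
      ∀ x' ∈ P.stepSetStar (beliefSupp b) (runPrefix ρ n),
        P.tr x' (ρ n).1 (ρ n).2 y ≠ 0 → x' = x) := by
  have hdom : ∀ n, P.stepSetStar (beliefSupp b) (runPrefix ρ n) ∈ f.dom := by
    intro n
    have := hρ (n + 1)
    rw [runPrefix_succ] at this
    exact insideFrom_snoc _ _ _ _ _ _ this
  have hsucc : ∀ n, ∀ x ∈ P.stepSetStar (beliefSupp b) (runPrefix ρ n),
      ∃ y, P.tr x (ρ n).1 (ρ n).2 y ≠ 0 ∧
      ∀ x' ∈ P.stepSetStar (beliefSupp b) (runPrefix ρ n),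
        P.tr x' (ρ n).1 (ρ n).2 y ≠ 0 → x' = x := by
    intro n
    apply P.exists_succ hP
    have := f.card_eq hP (hdom (n + 1)) (hdom n)
    rwa [runPrefix_succ, stepSetStar_snoc] at this
  refine ⟨?_, ?_, ?_, hsucc n⟩ <;> revert n
  all_goals
    suffices H : ∀ n,
        beliefSupp (P.belStepStar b (runPrefix ρ n))
          = P.stepSetStar (beliefSupp b) (runPrefix ρ n) ∧
        (∀ x, P.belStepStar b (runPrefix ρ n) x ≠ ⊤) ∧
        (∀ p ∈ beliefSupp b, ∃ x ∈ P.stepSetStar (beliefSupp b) (runPrefix ρ n),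
          P.stepSetStar {p} (runPrefix ρ n) = {x}) by
      intro n
      first | exact (H n).1 | exact (H n).2.1 | exact (H n).2.2
    intro n
    induction n with
    | zero =>
      refine ⟨rfl, hb, fun p hp => ⟨p, hp, rfl⟩⟩
    | succ n ih =>
      obtain ⟨h1, h2, h3⟩ := ih
      rw [runPrefix_succ]
      simp only [stepSetStar_snoc, belStepStar_snoc]
      refine ⟨?_, ?_, ?_⟩
      · rw [beliefSupp_belStep _ _ h2, h1]
      · intro x
        obtain ⟨z, hz, -⟩ := h3 q₀ hq₀
        obtain ⟨y, hy, -⟩ := hsucc n z hz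
        refine ENNReal.div_ne_top (ENNReal.sum_ne_top.2 fun w _ => ENNReal.mul_ne_top (h2 w) ?_)
          (P.trOBel_ne_zero _ (h1 ▸ hz) hy)
        exact ne_top_of_le_ne_top (P.trO_ne_top w (ρ n).1 (ρ n).2)
          (Finset.single_le_sum (f := fun v => P.tr w (ρ n).1 (ρ n).2 v) (fun _ _ => zero_le)
            (Finset.mem_univ x))
      · intro p hp
        obtain ⟨x, hx, e⟩ := h3 p hp
        obtain ⟨y, hy, -⟩ := hsucc n x hx
        exact ⟨y, (P.mem_stepSet' ..).2 ⟨x, hx, hy⟩, by rw [e, P.stepSet_singleton hP hy]⟩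

end POMDP

/-- In a posterior-deterministic POMDP, along an observable run
`ρ` inside an SEC `f` from `b`, the posterior probabilities are never `0` and the
ratios evolve by
`X_q^{n+1}/X_{q'}^{n+1} = (X_q^n/X_{q'}^n) · T(o | δ*(q,ρ|_n), a)/T(o | δ*(q',ρ|_n), a)`,
where `(a, o) = ρ(n)` is the `(n+1)`-st action-observation pair. -/
theorem stmt15 {Q A O : Type} [Fintype Q] [Fintype A] [Fintype O]
    (P : POMDP Q A O) (hP : P.PostDet)
    (f : POMDP.SEC P)
    (b : Q → ℝ≥0∞) (hb : (∑ q : Q, b q) = 1) (hS : beliefSupp b ∈ f.dom)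
    (q q' : Q) (hq : q ∈ beliefSupp b) (hq' : q' ∈ beliefSupp b)
    (ρ : ℕ → A × O) (hρ : POMDP.RunInside P f (beliefSupp b) ρ) (n : ℕ) :
    P.Xpost b q' ρ n ≠ 0 ∧
    P.Xpost b q ρ (n + 1) / P.Xpost b q' ρ (n + 1)
      = (P.Xpost b q ρ n / P.Xpost b q' ρ n) *
        ((∑ x ∈ P.stepSetStar {q} (runPrefix ρ n), P.trO x (ρ n).1 (ρ n).2)
          / (∑ x ∈ P.stepSetStar {q'} (runPrefix ρ n), P.trO x (ρ n).1 (ρ n).2)) := by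
  have hbt : ∀ q, b q ≠ ⊤ := by
    intro q
    refine ne_top_of_le_ne_top ENNReal.one_ne_top ?_
    rw [← hb]
    exact Finset.single_le_sum (f := b) (fun _ _ => zero_le) (Finset.mem_univ q)
  obtain ⟨h1, h2, h3, h4⟩ := P.run_invariant hP f b hbt ρ hρ q hq n
  obtain ⟨x, hx, ex⟩ := h3 q hq
  obtain ⟨x', hx', ex'⟩ := h3 q' hq'
  obtain ⟨y, hy, hyi⟩ := h4 x hx
  obtain ⟨y', hy', hyi'⟩ := h4 x' hx'
  have hX' : P.belStepStar b (runPrefix ρ n) x' ≠ 0 := by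
    rw [← h1] at hx'
    simpa [beliefSupp] using hx'
  have hZ0 := P.trOBel_ne_zero _ (h1 ▸ hx) hy
  have hZt := P.trOBel_ne_top _ h2 (ρ n).1 (ρ n).2
  have ht : P.trO x' (ρ n).1 (ρ n).2 ≠ 0 := by
    rw [P.trO_eq hP hy']
    exact hy'
  rw [← h1] at hyi hyi'
  simp only [POMDP.Xpost, POMDP.runPrefix_succ, POMDP.stepSetStar_snoc, POMDP.belStepStar_snoc,
    ex, ex', P.stepSet_singleton hP hy, P.stepSet_singleton hP hy', Finset.sum_singleton,
    P.belStep_apply hP _ hy hyi, P.belStep_apply hP _ hy' hyi']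
  refine ⟨hX', ?_⟩
  simp only [div_eq_mul_inv]
  rw [ENNReal.mul_inv (Or.inr (ENNReal.inv_ne_top.2 hZ0)) (Or.inr (ENNReal.inv_ne_zero.2 hZt)),
    ENNReal.mul_inv (Or.inl hX') (Or.inl (h2 x')), inv_inv]
  generalize P.trOBel _ _ _ = Z at *
  calc _ = (P.belStepStar b (runPrefix ρ n) x * (P.belStepStar b (runPrefix ρ n) x')⁻¹) *
        (P.trO x (ρ n).1 (ρ n).2 * (P.trO x' (ρ n).1 (ρ n).2)⁻¹) * (Z * Z⁻¹) := by ring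
    _ = _ := by rw [ENNReal.mul_inv_cancel hZ0 hZt, mul_one]
end

section
/- Let P be a posterior-deterministic POMDP and f an SEC of P. Then there exist N ∈ ℕ and β > 0 such that for every belief c with supp(c) ∈ dom f and all (f, supp(c))-distinguishable states q, q' ∈ supp(c), there exists an observable history h inside f from c, of length at most N, that distinguishes q and q' and satisfies P_c^{unif_f}(Cyl(h)) ≥ β. -/
open scoped ENNReal BigOperators Classical
open Filter Topology

namespace POMDP

variable {Q A O : Type} [Fintype Q] [Fintype A] [Fintype O]

theorem card_succs_le_one (P : POMDP Q A O) (hP : P.PostDet) (q : Q) (a : A) (o : O) :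
    (P.succs q a o).card ≤ 1 := by
  rw [Finset.card_le_one]
  intro x hx y hy
  simp only [succs, Finset.mem_filter] at hx hy
  exact hP q a o x y hx.2 hy.2

theorem stepSetStar_empty (P : POMDP Q A O) (h : List (A × O)) :
    P.stepSetStar ∅ h = ∅ := by
  induction h with
  | nil => rfl
  | cons x h ih =>
    obtain ⟨a, o⟩ := x
    have : P.stepSet ∅ a o = ∅ := by simp [stepSet]
    simp [stepSetStar, this, ih]

theorem stepSetStar_append (P : POMDP Q A O) (h h' : List (A × O)) :
    ∀ S : Finset Q, P.stepSetStar S (h ++ h') = P.stepSetStar (P.stepSetStar S h) h' := by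
  induction h with
  | nil => intro S; rfl
  | cons x h ih =>
    obtain ⟨a, o⟩ := x
    intro S
    exact ih _

theorem stepSetStar_mono (P : POMDP Q A O) (h : List (A × O)) :
    ∀ S S' : Finset Q, S ⊆ S' → P.stepSetStar S h ⊆ P.stepSetStar S' h := by
  induction h with
  | nil => intro S S' hs; exact hs
  | cons x h ih =>
    obtain ⟨a, o⟩ := x
    intro S S' hs
    exact ih _ _ (Finset.biUnion_subset_biUnion_of_subset_left _ hs)

theorem stepSet_nonempty_of_star (P : POMDP Q A O) (S : Finset Q) (h : List (A × O))
    (hne : (P.stepSetStar S h).Nonempty) : S.Nonempty := by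
  rw [Finset.nonempty_iff_ne_empty]
  rintro rfl
  rw [stepSetStar_empty] at hne
  exact Finset.not_nonempty_empty hne

theorem star_mem_dom (P : POMDP Q A O) (f : SEC P) (h : List (A × O)) :
    ∀ S ∈ f.dom, InsideFrom P f.dom f.act S h → (P.stepSetStar S h).Nonempty →
      P.stepSetStar S h ∈ f.dom := by
  induction h with
  | nil => intro S hS _ _; exact hS
  | cons x h ih =>
    obtain ⟨a, o⟩ := x
    intro S hS hin hne
    exact ih _ (f.closed S hS a hin.2.1 o (P.stepSet_nonempty_of_star _ h hne)) hin.2.2 hne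

theorem inside_append (P : POMDP Q A O) (f : SEC P) (h : List (A × O)) (a : A) (o : O) :
    ∀ S : Finset Q, InsideFrom P f.dom f.act S h → P.stepSetStar S h ∈ f.dom →
      a ∈ f.act (P.stepSetStar S h) → InsideFrom P f.dom f.act S (h ++ [(a, o)]) := by
  induction h with
  | nil => intro S _ hS ha; exact ⟨hS, ha, trivial⟩
  | cons x h ih =>
    obtain ⟨b, o'⟩ := x
    intro S hin hS ha
    exact ⟨hin.1, hin.2.1, ih _ hin.2.2 hS ha⟩

/-- Inside an SEC of a posterior-deterministic POMDP no state of the support dies. -/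
theorem succs_nonempty (P : POMDP Q A O) (hP : P.PostDet) (f : SEC P) (S : Finset Q)
    (hS : S ∈ f.dom) (a : A) (ha : a ∈ f.act S) (o : O) (hne : (P.stepSet S a o).Nonempty)
    (p : Q) (hp : p ∈ S) : (P.succs p a o).Nonempty := by
  by_contra hcon
  rw [Finset.not_nonempty_iff_eq_empty] at hcon
  obtain ⟨h, -, hh⟩ := f.connected _ (f.closed S hS a ha o hne) S hS
  have h1 : S.card ≤ (P.stepSet S a o).card := by
    conv_lhs => rw [← hh]
    exact P.card_stepSetStar_le hP h _
  have h2 : (P.stepSet S a o).card ≤ ∑ q ∈ S, (P.succs q a o).card := Finset.card_biUnion_le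
  have h3 : ∑ q ∈ S, (P.succs q a o).card < ∑ q ∈ S, 1 :=
    Finset.sum_lt_sum (fun q _ => P.card_succs_le_one hP q a o) ⟨p, hp, by simp [hcon]⟩
  simp at h3
  omega

theorem exists_path [Nonempty A] (P : POMDP Q A O) (hP : P.PostDet) (f : SEC P)
    (S0 : Finset Q) (h : List (A × O)) :
    ∀ (hist : List (A × O)) (S : Finset Q), P.stepSetStar S0 hist = S → S ∈ f.dom →
      InsideFrom P f.dom f.act S h → (P.stepSetStar S h).Nonempty → ∀ p ∈ S,
      ∃ l : List (A × O × Q), obsOf l = h ∧ P.runProbAux (P.unifStrat f S0) hist p l ≠ 0 := by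
  induction h with
  | nil => intro hist S _ _ _ _ p _; exact ⟨[], rfl, by simp [runProbAux]⟩
  | cons x h ih =>
    obtain ⟨a, o⟩ := x
    intro hist S hist_eq hS hin hne p hp
    have hne' : (P.stepSet S a o).Nonempty := P.stepSet_nonempty_of_star _ h hne
    obtain ⟨p', hp'⟩ := P.succs_nonempty hP f S hS a hin.2.1 o hne' p hp
    have hmem : p' ∈ P.stepSet S a o := Finset.mem_biUnion.2 ⟨p, hp, hp'⟩
    obtain ⟨l, hl, hl0⟩ := ih (hist ++ [(a, o)]) (P.stepSet S a o)
      (by rw [stepSetStar_append, hist_eq]; rfl) (f.closed S hS a hin.2.1 o hne') hin.2.2 hne p' hmem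
    refine ⟨(a, o, p') :: l, by simpa [obsOf] using hl, ?_⟩
    have hact : (P.unifStrat f S0).act hist a ≠ 0 := by
      have hu : P.unifSupport f S0 hist = f.act S := by
        unfold unifSupport
        rw [hist_eq, if_pos (f.act_nonempty S hS)]
      simp [unifStrat, hu, hin.2.1]
    have htr : P.tr p a o p' ≠ 0 := by
      simpa [succs] using hp'
    exact mul_ne_zero (mul_ne_zero hact htr) hl0

theorem cyl_bound [Nonempty A] (P : POMDP Q A O) (hP : P.PostDet) (f : SEC P)
    (S : Finset Q) (hS : S ∈ f.dom) (h : List (A × O))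
    (hin : InsideFrom P f.dom f.act S h) (hne : (P.stepSetStar S h).Nonempty) :
    ∃ β : ℝ≥0∞, 0 < β ∧ ∀ c : Q → ℝ≥0∞, (∑ q : Q, c q) = 1 → beliefSupp c = S →
      β ≤ P.obsCylProb c (P.unifStrat f S) h := by
  have key := P.exists_path hP f S h [] S rfl hS hin hne
  choose! l hl hl0 using key
  refine ⟨S.inf fun p => P.runProbAux (P.unifStrat f S) [] p (l p), ?_, ?_⟩
  · rw [Finset.lt_inf_iff (by simp)]
    intro p hp
    exact pos_iff_ne_zero.2 (hl0 p hp)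
  · intro c hc hcS
    set β := S.inf fun p => P.runProbAux (P.unifStrat f S) [] p (l p) with hβ
    unfold obsCylProb
    have hz : ∀ q ∉ S, c q = 0 := by
      intro q hq
      by_contra h0
      exact hq (by rw [← hcS]; simp [beliefSupp, h0])
    have hinj : Function.Injective (fun q : Q => ((q, l q) : Q × List (A × O × Q))) := by
      intro x y hxy
      exact (Prod.ext_iff.1 hxy).1
    calc β = ∑ q : Q, c q * β := by rw [← Finset.sum_mul, hc, one_mul]
      _ ≤ ∑ q : Q, (if obsOf (l q) = h then P.histProb c (P.unifStrat f S) q (l q) else 0) := by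
          refine Finset.sum_le_sum fun q _ => ?_
          by_cases hq : q ∈ S
          · rw [if_pos (hl q hq)]
            unfold histProb
            gcongr
            exact Finset.inf_le hq
          · simp [hz q hq]
      _ = ∑' q : Q, (if obsOf (l q) = h then P.histProb c (P.unifStrat f S) q (l q) else 0) :=
          (tsum_fintype _).symm
      _ ≤ _ := ENNReal.tsum_comp_le_tsum_of_injective hinj
          (fun p : Q × List (A × O × Q) =>
            if obsOf p.2 = h then P.histProb c (P.unifStrat f S) p.1 p.2 else 0)

theorem star_singleton (P : POMDP Q A O) (hP : P.PostDet) (q x : Q) (h : List (A × O))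
    (hx : x ∈ P.stepSetStar {q} h) : P.stepSetStar {q} h = {x} := by
  have h1 := P.card_stepSetStar_le hP h {q}
  rw [Finset.card_singleton, Finset.card_le_one] at h1
  ext y
  rw [Finset.mem_singleton]
  exact ⟨fun hy => h1 y hy x hx, fun hy => hy ▸ hx⟩

theorem exists_dist (P : POMDP Q A O) (hP : P.PostDet) (f : SEC P)
    (S : Finset Q) (hS : S ∈ f.dom) (q : Q) (hq : q ∈ S) (q' : Q) (hq' : q' ∈ S)
    (hd : ¬ Indist P f S q q') :
    ∃ h : List (A × O), InsideFrom P f.dom f.act S h ∧ (P.stepSetStar S h).Nonempty ∧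
      P.HistDistinguishes q q' h := by
  unfold Indist at hd
  push Not at hd
  obtain ⟨h, hin, a, ha, o, x, hx, y, hy, hxy⟩ := hd
  have hxS : x ∈ P.stepSetStar S h :=
    P.stepSetStar_mono h _ _ (Finset.singleton_subset_iff.2 hq) hx
  have hyS : y ∈ P.stepSetStar S h :=
    P.stepSetStar_mono h _ _ (Finset.singleton_subset_iff.2 hq') hy
  have hdom := P.star_mem_dom f h S hS hin ⟨x, hxS⟩
  refine ⟨h ++ [(a, o)], P.inside_append f h a o S hin hdom ha, ?_, h, (a, o), rfl, ?_⟩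
  · rw [stepSetStar_append]
    have pos : ∀ z ∈ P.stepSetStar S h, P.trO z a o ≠ 0 →
        (P.stepSet (P.stepSetStar S h) a o).Nonempty := by
      intro z hz h0
      obtain ⟨w, -, hw⟩ := Finset.exists_ne_zero_of_sum_ne_zero h0
      exact ⟨w, Finset.mem_biUnion.2 ⟨z, hz, by simp [succs, hw]⟩⟩
    by_cases h0 : P.trO x a o = 0
    · exact pos y hyS (fun h1 => hxy (h0.trans h1.symm))
    · exact pos x hxS h0
  · rw [P.star_singleton hP q x h hx, P.star_singleton hP q' y h hy]
    simpa using hxy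

end POMDP

/-- For a posterior-deterministic POMDP and an SEC `f`, there
are `N ∈ ℕ` and `β > 0` such that for every belief `c` with `supp(c) ∈ dom f` and
all `(f, supp(c))`-distinguishable `q, q' ∈ supp(c)`, some observable history `h`
inside `f` from `c` of length at most `N` distinguishes `q` and `q'` and has
probability at least `β` under the uniform strategy. -/
theorem stmt17 {Q A O : Type} [Fintype Q] [Fintype A] [Fintype O] [Nonempty A]
    (P : POMDP Q A O) (hP : P.PostDet) (f : POMDP.SEC P) :
    ∃ (N : ℕ) (β : ℝ≥0∞), 0 < β ∧
      ∀ c : Q → ℝ≥0∞, (∑ q : Q, c q) = 1 → beliefSupp c ∈ f.dom →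
        ∀ q ∈ beliefSupp c, ∀ q' ∈ beliefSupp c,
          ¬ POMDP.Indist P f (beliefSupp c) q q' →
          ∃ h : List (A × O),
            POMDP.InsideFrom P f.dom f.act (beliefSupp c) h ∧
            h.length ≤ N ∧
            P.HistDistinguishes q q' h ∧
            β ≤ P.obsCylProb c (P.unifStrat f (beliefSupp c)) h := by
  have key : ∀ t : Finset Q × Q × Q, ∃ (N : ℕ) (β : ℝ≥0∞), 0 < β ∧
      ∀ c : Q → ℝ≥0∞, (∑ q : Q, c q) = 1 → beliefSupp c = t.1 → t.1 ∈ f.dom →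
        t.2.1 ∈ t.1 → t.2.2 ∈ t.1 → ¬ POMDP.Indist P f t.1 t.2.1 t.2.2 →
          ∃ h : List (A × O), POMDP.InsideFrom P f.dom f.act t.1 h ∧ h.length ≤ N ∧
            P.HistDistinguishes t.2.1 t.2.2 h ∧
            β ≤ P.obsCylProb c (P.unifStrat f t.1) h := by
    rintro ⟨S, q, q'⟩
    by_cases hyp : S ∈ f.dom ∧ q ∈ S ∧ q' ∈ S ∧ ¬ POMDP.Indist P f S q q'
    · obtain ⟨hS, hq, hq', hd⟩ := hyp
      obtain ⟨h, hin, hne, hdist⟩ := P.exists_dist hP f S hS q hq q' hq' hd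
      obtain ⟨β, hβ, hb⟩ := P.cyl_bound hP f S hS h hin hne
      exact ⟨h.length, β, hβ, fun c hc hcS _ _ _ _ => ⟨h, hin, le_rfl, hdist, hb c hc hcS⟩⟩
    · exact ⟨0, 1, one_pos, fun c _ _ h1 h2 h3 h4 => absurd ⟨h1, h2, h3, h4⟩ hyp⟩
  choose N β hβ hb using key
  refine ⟨Finset.univ.sup N, Finset.univ.inf β, ?_, ?_⟩
  · rw [Finset.lt_inf_iff (by simp)]
    exact fun t _ => hβ t
  · intro c hc hS q hq q' hq' hd
    obtain ⟨h, h1, h2, h3, h4⟩ := hb (beliefSupp c, q, q') c hc rfl hS hq hq' hd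
    exact ⟨h, h1, h2.trans (Finset.le_sup (Finset.mem_univ _)), h3,
      (Finset.inf_le (Finset.mem_univ _)).trans h4⟩
end
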